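/- arXiv:1803.01175 — 2 statements merged into one kernel-verified Lean document; each statement's English description precedes it below -/
import Mathlib

section
/- Let (Ω, 𝔉, P) be a probability space, N : Ω → ℕ a random variable with N ≥ 1 a.s., and Y_1, Y_2, … : Ω → ℝ random variables such that Y_j · 1{N = k} is integrable for all j ≤ k and all k, the cluster average g = (1/N) Σ_{j=1}^{N} Y_j is integrable, and Y_1 is integrable. If for every k ≥ 1 and every 1 ≤ j ≤ k one has E[Y_j · 1{N = k}] = E[Y_1 · 1{N = k}] (the observed outcomes are identically distributed within each cluster-size stratum, as holds under exchangeability), then E[(1/N) Σ_{j=1}^{N} Y_j] = E[Y_1]. -/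
open MeasureTheory Set

/-- If within each cluster-size stratum `{N = k}` the observed outcomes `Y_1, …, Y_k`
are identically distributed in the sense that `E[Y_j 1{N = k}] = E[Y_1 1{N = k}]` for
all `1 ≤ j ≤ k` (as holds under exchangeability), then the inverse-cluster-size-weighted
mean functional equals the marginal mean: `E[(1/N) ∑_{j=1}^N Y_j] = E[Y_1]`. -/
theorem stmt3 {Ω : Type*} [MeasurableSpace Ω] (P : Measure Ω) [IsProbabilityMeasure P]
    (N : Ω → ℕ) (Y : ℕ → Ω → ℝ)
    (hNmeas : Measurable N) (hYmeas : ∀ j, Measurable (Y j))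
    (hN : ∀ᵐ ω ∂P, 1 ≤ N ω)
    (hint : ∀ k, 1 ≤ k → ∀ j, 1 ≤ j → j ≤ k →
      Integrable (fun ω => ({ω' | N ω' = k}).indicator (Y j) ω) P)
    (hg : Integrable (fun ω => ((N ω : ℝ))⁻¹ * ∑ j ∈ Finset.Icc 1 (N ω), Y j ω) P)
    (hY1 : Integrable (Y 1) P)
    (heq : ∀ k, 1 ≤ k → ∀ j, 1 ≤ j → j ≤ k →
      ∫ ω, ({ω' | N ω' = k}).indicator (Y j) ω ∂P =
      ∫ ω, ({ω' | N ω' = k}).indicator (Y 1) ω ∂P) :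
    ∫ ω, ((N ω : ℝ))⁻¹ * ∑ j ∈ Finset.Icc 1 (N ω), Y j ω ∂P = ∫ ω, Y 1 ω ∂P := by
  have hm : ∀ k : ℕ, MeasurableSet {ω | N ω = k} := fun k =>
    hNmeas (measurableSet_singleton k)
  have hU : (⋃ k : ℕ, {ω | N ω = k}) = Set.univ := by
    ext ω; simp
  have hd : Pairwise (Function.onFun Disjoint (fun k : ℕ => {ω | N ω = k})) := by
    intro a b hab
    refine Set.disjoint_left.2 ?_
    intro ω ha hb
    exact hab (ha.symm.trans hb)
  have key : ∀ f : Ω → ℝ, Integrable f P →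
      ∫ ω, f ω ∂P = ∑' k : ℕ, ∫ ω in {ω | N ω = k}, f ω ∂P := by
    intro f hf
    rw [← integral_iUnion hm hd hf.integrableOn, hU, Measure.restrict_univ]
  rw [key _ hg, key _ hY1]
  congr 1
  funext k
  rcases Nat.eq_zero_or_pos k with rfl | hk
  · have h0 : P {ω | N ω = 0} = 0 := by
      refine measure_mono_null ?_ (ae_iff.1 hN)
      intro ω h
      simp only [mem_setOf_eq] at h ⊢
      omega
    rw [Measure.restrict_eq_zero.2 h0]
    simp
  · have h1 : ∫ ω in {ω | N ω = k}, ((N ω : ℝ))⁻¹ * ∑ j ∈ Finset.Icc 1 (N ω), Y j ω ∂P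
        = ∫ ω in {ω | N ω = k}, ((k : ℝ))⁻¹ * ∑ j ∈ Finset.Icc 1 k, Y j ω ∂P := by
      refine setIntegral_congr_fun (hm k) ?_
      intro ω h
      simp only [mem_setOf_eq] at h
      simp only [h]
    rw [h1, integral_const_mul, integral_finsetSum]
    · have h2 : ∀ j ∈ Finset.Icc 1 k, ∫ ω in {ω | N ω = k}, Y j ω ∂P
          = ∫ ω in {ω | N ω = k}, Y 1 ω ∂P := by
        intro j hj
        rw [Finset.mem_Icc] at hj
        have := heq k hk j hj.1 hj.2
        rwa [integral_indicator (hm k), integral_indicator (hm k)] at this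
      rw [Finset.sum_congr rfl h2]
      have : (k : ℝ) ≠ 0 := by positivity
      simp [this]
    · intro j hj
      rw [Finset.mem_Icc] at hj
      exact (integrable_indicator_iff (hm k)).1 (hint k hk j hj.1 hj.2)
end

section
/- Let (Ω, 𝔉, P) be a probability space, 𝒩 ⊆ 𝔉 a sub-σ-algebra, J a finite index set, and θ ∈ ℝ. Let W_j ≥ 0, j ∈ J, be bounded 𝒩-measurable random variables with Σ_{j∈J} W_j > 0 a.s., and let Y_j, j ∈ J, be integrable random variables such that E[Y_j | 𝒩] = θ a.s. on the event {W_j > 0}, for each j. Then the weighted mean (Σ_{j∈J} W_j Y_j) / (Σ_{j∈J} W_j) is integrable with expectation θ. -/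
open MeasureTheory

/-- If the nonnegative bounded weights `W_j` are measurable with respect to a sub-σ-algebra
`𝒩` (e.g. the σ-algebra generated by the cluster sizes), `∑_j W_j > 0` a.s., and each `Y_j`
is integrable with `E[Y_j | 𝒩] = θ` a.s. on `{W_j > 0}`, then the weighted mean
`(∑_j W_j Y_j)/(∑_j W_j)` is integrable and unbiased for `θ`. -/
theorem stmt5 {Ω : Type*} {mΩ : MeasurableSpace Ω} (P : Measure Ω) [IsProbabilityMeasure P]
    (m : MeasurableSpace Ω) (hm : m ≤ mΩ)
    {J : Type*} [Fintype J] (θ : ℝ) (W Y : J → Ω → ℝ)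
    (hWnn : ∀ j ω, 0 ≤ W j ω)
    (hWmeas : ∀ j, Measurable[m] (W j))
    (hWbdd : ∀ j, ∃ C, ∀ ω, W j ω ≤ C)
    (hWpos : ∀ᵐ ω ∂P, 0 < ∑ j, W j ω)
    (hYint : ∀ j, Integrable (Y j) P)
    (hcond : ∀ j, ∀ᵐ ω ∂P, 0 < W j ω → (P[Y j|m]) ω = θ) :
    Integrable (fun ω => (∑ j, W j ω * Y j ω) / (∑ j, W j ω)) P ∧
    ∫ ω, (∑ j, W j ω * Y j ω) / (∑ j, W j ω) ∂P = θ := by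
  have hVm : ∀ j, StronglyMeasurable[m] (fun ω => W j ω / ∑ k, W k ω) := fun j =>
    ((hWmeas j).div (Finset.measurable_fun_sum _ fun k _ => hWmeas k)).stronglyMeasurable
  have hVb : ∀ j ω, ‖W j ω / ∑ k, W k ω‖ ≤ 1 := by
    intro j ω
    have h0 : 0 ≤ ∑ k, W k ω := Finset.sum_nonneg fun k _ => hWnn k ω
    rw [Real.norm_of_nonneg (div_nonneg (hWnn j ω) h0)]
    exact div_le_one_of_le₀
      (Finset.single_le_sum (f := fun k => W k ω) (fun k _ => hWnn k ω) (Finset.mem_univ j)) h0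
  have hVi : ∀ j, Integrable (fun ω => W j ω / ∑ k, W k ω) P := fun j =>
    Integrable.of_bound ((hVm j).mono hm).aestronglyMeasurable 1 (ae_of_all _ (hVb j))
  have hint : ∀ j, Integrable ((fun ω => W j ω / ∑ k, W k ω) * Y j) P := fun j =>
    (hYint j).bdd_mul ((hVm j).mono hm).aestronglyMeasurable (ae_of_all _ (hVb j))
  have hE : ∀ j, ∫ ω, ((fun ω => W j ω / ∑ k, W k ω) * Y j) ω ∂P
      = ∫ ω, (W j ω / ∑ k, W k ω) * θ ∂P := by
    intro j
    rw [← integral_condExp hm]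
    apply integral_congr_ae
    filter_upwards [condExp_mul_of_stronglyMeasurable_left (hVm j) (hint j) (hYint j),
      hcond j] with ω h1 h2
    rw [h1, Pi.mul_apply]
    rcases (hWnn j ω).eq_or_lt with h | h
    · simp [← h]
    · rw [h2 h]
  have hfun : (fun ω => (∑ j, W j ω * Y j ω) / (∑ j, W j ω))
      = fun ω => ∑ j, ((fun ω => W j ω / ∑ k, W k ω) * Y j) ω := by
    funext ω
    rw [Finset.sum_div]
    refine Finset.sum_congr rfl fun j _ => ?_
    simp only [Pi.mul_apply]
    ring
  rw [hfun]
  refine ⟨integrable_finsetSum _ fun j _ => hint j, ?_⟩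
  rw [integral_finsetSum _ fun j _ => hint j, Finset.sum_congr rfl fun j _ => hE j,
    ← integral_finsetSum _ fun j _ => (hVi j).mul_const θ]
  have : (fun ω => ∑ j, (W j ω / ∑ k, W k ω) * θ) =ᵐ[P] fun _ => θ := by
    filter_upwards [hWpos] with ω h
    rw [← Finset.sum_mul, ← Finset.sum_div, div_self h.ne', one_mul]
  rw [integral_congr_ae this]
  simp
end
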